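/- arXiv:2602.11448 — 5 statements merged into one kernel-verified Lean document; each statement's English description precedes it below -/
import Mathlib

section
/- Let b ≥ 2 and L ≥ 0 be natural numbers and let a_0, a_1, …, a_L ∈ ℝ^d be linearly independent vectors. Suppose there exist vectors g, c_1, …, c_b ∈ ℝ^d and a real number λ > 0 such that: (i) hierarchical orthogonality holds, i.e. ⟨c_j − a_k, a_k⟩ = 0 and ⟨g − a_k, a_k⟩ = 0 for every j ∈ {1,…,b} and every k ∈ {0,…,L}; and (ii) the differences form a regular (b−1)-simplex, i.e. ⟨c_j − g, c_{j'} − g⟩ = λ² if j = j' and ⟨c_j − g, c_{j'} − g⟩ = −λ²/(b−1) if j ≠ j'. Then the ambient dimension satisfies the depth–dimension condition d ≥ L + b. -/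
open scoped RealInnerProductSpace

/-- Dropping one vertex vector of a regular simplex leaves a linearly independent family. -/
theorem linearIndependent_castSucc_of_regular_simplex
    {E : Type*} [NormedAddCommGroup E] [InnerProductSpace ℝ E]
    {n : ℕ} (hn : 0 < n) (w : Fin (n + 1) → E) {r : ℝ} (hr : 0 < r)
    (hw : ∀ i j, ⟪w i, w j⟫ = if i = j then r else -(r / n)) :
    LinearIndependent ℝ fun i : Fin n => w i.castSucc := by
  have hn' : (0 : ℝ) < n := by exact_mod_cast hn
  rw [Fintype.linearIndependent_iff]
  intro x hx i
  have hinner : ∀ k, ∑ j, x j * ⟪w k, w j.castSucc⟫ = 0 := by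
    intro k
    have h := congrArg (fun v => ⟪w k, v⟫) hx
    simpa [inner_sum, real_inner_smul_right] using h
  have hsum : ∑ j, x j = 0 := by
    have h := hinner (Fin.last n)
    simp only [hw, (Fin.castSucc_ne_last _).symm, if_false, ← Finset.sum_mul] at h
    exact (mul_eq_zero.mp h).resolve_right (neg_ne_zero.mpr (by positivity))
  have hsplit : ∀ j, x j * ⟪w i.castSucc, w j.castSucc⟫ =
      (if i = j then x j * (r + r / n) else 0) - x j * (r / n) := by
    intro j
    rw [hw]
    by_cases hij : i = j
    · simp only [hij, if_true]
      ring
    · simp [hij]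
  have h := hinner i.castSucc
  simp only [hsplit, Finset.sum_sub_distrib, ← Finset.sum_mul, hsum, Finset.sum_ite_eq,
    Finset.mem_univ, if_true, zero_mul, sub_zero] at h
  exact (mul_eq_zero.mp h).resolve_right (by positivity)

/-- **Depth–dimension necessity.**
Let `a 0, …, a L ∈ ℝ^d` be linearly independent, and suppose there exist
`g, c 1, …, c b ∈ ℝ^d` (with `b ≥ 2`) and `λ > 0` such that hierarchical
orthogonality holds (`⟪c j - a k, a k⟫ = 0` and `⟪g - a k, a k⟫ = 0` for all
`j`, `k`) and the differences `c j - g` form a regular `(b-1)`-simplex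
(`⟪c j - g, c j' - g⟫ = λ²` if `j = j'` and `-λ²/(b-1)` otherwise).
Then `d ≥ L + b`. -/
theorem depth_dimension_necessity
    {d L b : ℕ} (hb : 2 ≤ b)
    (a : Fin (L + 1) → EuclideanSpace ℝ (Fin d))
    (hli : LinearIndependent ℝ a)
    (g : EuclideanSpace ℝ (Fin d)) (c : Fin b → EuclideanSpace ℝ (Fin d))
    (lam : ℝ) (hlam : 0 < lam)
    (horthc : ∀ (j : Fin b) (k : Fin (L + 1)), ⟪c j - a k, a k⟫ = 0)
    (horthg : ∀ k : Fin (L + 1), ⟪g - a k, a k⟫ = 0)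
    (hsimplex : ∀ j j' : Fin b, ⟪c j - g, c j' - g⟫ =
      if j = j' then lam ^ 2 else -(lam ^ 2 / ((b : ℝ) - 1))) :
    L + b ≤ d := by
  obtain ⟨n, rfl⟩ : ∃ n, b = n + 1 := ⟨b - 1, by omega⟩
  have hw : LinearIndependent ℝ fun i : Fin n => c i.castSucc - g := by
    refine linearIndependent_castSucc_of_regular_simplex (by omega) (fun j => c j - g)
      (pow_pos hlam 2) fun i j => ?_
    simpa using hsimplex i j
  have hortho : ∀ k j, ⟪a k, c j - g⟫ = 0 := by
    intro k j
    rw [real_inner_comm, ← sub_sub_sub_cancel_right (c j) g (a k), inner_sub_left, horthc,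
      horthg, sub_zero]
  have hspan : Submodule.span ℝ (Set.range a) ⟂
      Submodule.span ℝ (Set.range fun i : Fin n => c i.castSucc - g) := by
    rw [Submodule.isOrtho_span]
    rintro _ ⟨k, rfl⟩ _ ⟨j, rfl⟩
    exact hortho k j.castSucc
  have hcard := (hli.sum_type hw hspan.disjoint).fintype_card_le_finrank
  simp only [Fintype.card_sum, Fintype.card_fin, finrank_euclideanSpace] at hcard
  omega
end

section
/- Let b ≥ 2 be a natural number, λ > 0 a real number, and v_1, …, v_b vectors in a real inner product space such that ⟨v_j, v_{j'}⟩ = λ² if j = j' and ⟨v_j, v_{j'}⟩ = −λ²/(b−1) if j ≠ j'. Then ∑_{j=1}^{b} v_j = 0 and the linear span of {v_1, …, v_b} has dimension exactly b − 1; in particular, any subspace containing all the v_j has dimension at least b − 1. -/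
open scoped RealInnerProductSpace

section EquiangularFamily

variable {E : Type*} [NormedAddCommGroup E] [InnerProductSpace ℝ E]

/-- Inner products with linear combinations of a family whose Gram matrix has constant diagonal
and constant off-diagonal entries. -/
theorem inner_sum_smul_of_constant_gram {ι : Type*} [Fintype ι] [DecidableEq ι] {a c : ℝ}
    {v : ι → E} (hv : ∀ i j, ⟪v i, v j⟫ = if i = j then a else -c) (g : ι → ℝ) (k : ι) :
    ⟪v k, ∑ j, g j • v j⟫ = g k * (a + c) - c * ∑ j, g j := by
  have h : ∀ j, g j * ⟪v k, v j⟫ = (if k = j then g j * (a + c) else 0) - c * g j := by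
    intro j
    rw [hv]
    split_ifs <;> ring
  simp_rw [inner_sum, real_inner_smul_right, h]
  rw [Finset.sum_sub_distrib, Finset.sum_ite_eq, ← Finset.mul_sum]
  simp

/-- A family with constant Gram entries sums to zero if the rows of its Gram matrix do. -/
theorem sum_eq_zero_of_constant_gram {ι : Type*} [Fintype ι] [DecidableEq ι] {a c : ℝ}
    {v : ι → E} (hv : ∀ i j, ⟪v i, v j⟫ = if i = j then a else -c)
    (h : a + c = c * Fintype.card ι) : ∑ j, v j = 0 := by
  have horth : ∀ k, ⟪v k, ∑ j, v j⟫ = 0 := by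
    intro k
    simpa [h] using inner_sum_smul_of_constant_gram hv (fun _ => 1) k
  rw [← inner_self_eq_zero (𝕜 := ℝ), sum_inner]
  exact Finset.sum_eq_zero fun k _ => horth k

/-- Dropping one vector from a family with constant Gram entries leaves a linearly independent
family, provided the off-diagonal entry is nonzero and differs from the diagonal one. -/
theorem linearIndependent_succ_of_constant_gram {n : ℕ} {a c : ℝ} {v : Fin (n + 1) → E}
    (hv : ∀ i j, ⟪v i, v j⟫ = if i = j then a else -c) (hc : c ≠ 0) (hac : a + c ≠ 0) :
    LinearIndependent ℝ fun i : Fin n => v i.succ := by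
  rw [Fintype.linearIndependent_iff]
  intro g hg
  have key := inner_sum_smul_of_constant_gram hv (Fin.cons 0 g : Fin (n + 1) → ℝ)
  simp only [Fin.sum_univ_succ, Fin.cons_zero, Fin.cons_succ, zero_smul, zero_add, hg,
    inner_zero_right] at key
  have hsum : ∑ i, g i = 0 := by simpa [hc] using key 0
  intro i
  simpa [hsum, hac] using key i.succ

end EquiangularFamily

/-- **Regular simplex vertices sum to zero and span a `(b-1)`-dimensional space.**
If `v 1, …, v b` (with `b ≥ 2`) in a real inner product space satisfy
`⟪v j, v j'⟫ = λ²` for `j = j'` and `⟪v j, v j'⟫ = -λ²/(b-1)` for `j ≠ j'`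
with `λ > 0`, then `∑ j, v j = 0`, the span of the `v j` has dimension exactly
`b - 1`, and any subspace containing all the `v j` has dimension at least
`b - 1`. -/
theorem regular_simplex_sum_zero_and_span_dim
    {E : Type*} [NormedAddCommGroup E] [InnerProductSpace ℝ E]
    {b : ℕ} (hb : 2 ≤ b) (lam : ℝ) (hlam : 0 < lam)
    (v : Fin b → E)
    (hv : ∀ j j' : Fin b, ⟪v j, v j'⟫ =
      if j = j' then lam ^ 2 else -(lam ^ 2 / ((b : ℝ) - 1))) :
    (∑ j, v j = 0) ∧
    Module.finrank ℝ (Submodule.span ℝ (Set.range v)) = b - 1 ∧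
    (∀ W : Submodule ℝ E, (∀ j, v j ∈ W) →
      ((b - 1 : ℕ) : Cardinal) ≤ Module.rank ℝ W) := by
  obtain ⟨n, rfl⟩ : ∃ n, b = n + 1 := ⟨b - 1, by omega⟩
  have hn : (0 : ℝ) < n := by exact_mod_cast (by omega : 0 < n)
  simp only [Nat.cast_add, Nat.cast_one, add_sub_cancel_right] at hv
  have hc : 0 < lam ^ 2 / n := by positivity
  have hsum : ∑ j, v j = 0 := by
    refine sum_eq_zero_of_constant_gram hv ?_
    rw [Fintype.card_fin]
    push_cast
    field_simp
  have hli := linearIndependent_succ_of_constant_gram hv hc.ne' (by positivity)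
  rw [Nat.add_sub_cancel]
  refine ⟨hsum, ?_, fun W hW => ?_⟩
  · have hspan : Submodule.span ℝ (Set.range v) =
        Submodule.span ℝ (Set.range fun i : Fin n => v i.succ) := by
      apply le_antisymm
      · rw [Submodule.span_le]
        rintro _ ⟨j, rfl⟩
        have hmem (i : Fin n) := Submodule.subset_span (R := ℝ)
          (Set.mem_range_self (f := fun i : Fin n => v i.succ) i)
        refine Fin.cases ?_ hmem j
        rw [Fin.sum_univ_succ] at hsum
        rw [eq_neg_of_add_eq_zero_left hsum]
        exact neg_mem (sum_mem fun i _ => hmem i)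
      · exact Submodule.span_mono (Set.range_subset_iff.2 fun i => Set.mem_range_self i.succ)
    rw [hspan, finrank_span_eq_card hli, Fintype.card_fin]
  · have hliW : LinearIndependent ℝ fun i : Fin n => (⟨v i.succ, hW i.succ⟩ : W) :=
      LinearIndependent.of_comp W.subtype hli
    simpa using hliW.cardinal_lift_le_rank
end

section
/- Let D ∈ ℝ^{d×k} have nonzero columns d_1, …, d_k with column-normalized version d̂_j = d_j/‖d_j‖₂, let T ⊆ {1,…,k}, and let S ⊆ T be a nonempty set of size s such that D_S has full column rank and ERC(D̂; S | T) = max_{j ∈ T∖S} ‖D̂_S† d̂_j‖₁ < 1. Let x = ∑_{j∈S} z_j d_j with z_j ≠ 0 for every j ∈ S. Then OMP with the cosine-similarity selection rule restricted to the columns indexed by T recovers S exactly in s steps: at every iteration t < s the residual r^t is nonzero and every index maximizing j ↦ |⟨r^t, d_j⟩|/‖d_j‖₂ over j ∈ T lies in S ∖ S^t, and after s iterations the selected support equals S and the residual is zero. -/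
open Matrix
open scoped NNReal

/-- The Euclidean norm of the `j`-th column of `D`. -/
noncomputable def colNorm {d k : ℕ} (D : Matrix (Fin d) (Fin k) ℝ)
    (j : Fin k) : ℝ :=
  Real.sqrt (∑ i, (D i j) ^ 2)

/-- The column-normalized dictionary `D̂` with columns `d̂_j = d_j / ‖d_j‖₂`. -/
noncomputable def normalizeCols {d k : ℕ} (D : Matrix (Fin d) (Fin k) ℝ) :
    Matrix (Fin d) (Fin k) ℝ :=
  Matrix.of fun i j => D i j / colNorm D j

/-- The submatrix of columns of `D` indexed by the finset `S`. -/
noncomputable def subCols {d k : ℕ} (D : Matrix (Fin d) (Fin k) ℝ)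
    (S : Finset (Fin k)) : Matrix (Fin d) {j // j ∈ S} ℝ :=
  Matrix.of fun i j => D i j.1

/-- The pseudoinverse `D_S† = (D_Sᵀ D_S)⁻¹ D_Sᵀ` of the full column rank
submatrix `D_S`. -/
noncomputable def pinvCols {d k : ℕ} (D : Matrix (Fin d) (Fin k) ℝ)
    (S : Finset (Fin k)) : Matrix {j // j ∈ S} (Fin d) ℝ :=
  ((subCols D S)ᵀ * subCols D S)⁻¹ * (subCols D S)ᵀ

/-- The restricted exact recovery coefficient
`ERC(D; S | T) = max_{j ∈ T \ S} ‖D_S† d_j‖₁` (maximum over the empty set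
being `0`). -/
noncomputable def ERC {d k : ℕ} (D : Matrix (Fin d) (Fin k) ℝ)
    (S T : Finset (Fin k)) : ℝ≥0 :=
  (T \ S).sup fun j => ∑ i, ‖(pinvCols D S).mulVec (fun i' => D i' j) i‖₊

/-- The Euclidean norm of a vector in `Fin d → ℝ`. -/
noncomputable def norm2 {d : ℕ} (v : Fin d → ℝ) : ℝ :=
  Real.sqrt (∑ i, (v i) ^ 2)

theorem colNorm_pos {d k : ℕ} {D : Matrix (Fin d) (Fin k) ℝ} {j : Fin k}
    (h : (fun i => D i j) ≠ (0 : Fin d → ℝ)) : 0 < colNorm D j := by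
  obtain ⟨i, hi⟩ := Function.ne_iff.mp h
  exact Real.sqrt_pos.mpr (Finset.sum_pos' (fun i _ => sq_nonneg _)
    ⟨i, Finset.mem_univ _, by have : D i j ≠ 0 := hi; positivity⟩)

theorem norm2_le_norm2_iff {d : ℕ} (u v : Fin d → ℝ) :
    norm2 u ≤ norm2 v ↔ u ⬝ᵥ u ≤ v ⬝ᵥ v := by
  simp only [norm2, dotProduct, ← sq]
  exact Real.sqrt_le_sqrt_iff (Finset.sum_nonneg fun i _ => sq_nonneg _)

/-- A vector that cannot be shortened by subtracting multiples of `v` is orthogonal to `v`. -/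
theorem dotProduct_eq_zero_of_norm2_le {d : ℕ} {r v : Fin d → ℝ}
    (h : ∀ ε : ℝ, norm2 r ≤ norm2 (r - ε • v)) : r ⬝ᵥ v = 0 := by
  rcases eq_or_ne v 0 with rfl | hv
  · simp
  have hvv : 0 < v ⬝ᵥ v := by
    refine lt_of_le_of_ne (Finset.sum_nonneg fun i _ => mul_self_nonneg _) ?_
    exact fun h0 => hv (dotProduct_self_eq_zero.mp h0.symm)
  have h1 := (norm2_le_norm2_iff _ _).mp (h (r ⬝ᵥ v / v ⬝ᵥ v))
  simp only [sub_dotProduct, dotProduct_sub, smul_dotProduct, dotProduct_smul, smul_eq_mul,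
    dotProduct_comm v r, div_mul_cancel₀ _ hvv.ne'] at h1
  have h2 : 0 ≤ -(r ⬝ᵥ v / v ⬝ᵥ v * r ⬝ᵥ v) := by linarith
  have h3 : (r ⬝ᵥ v) ^ 2 / v ⬝ᵥ v ≤ 0 := by
    rw [sq, ← div_mul_eq_mul_div]; linarith
  have h4 : (r ⬝ᵥ v) ^ 2 ≤ 0 := by
    by_contra! h5
    exact absurd (div_pos h5 hvv) h3.not_gt
  exact pow_eq_zero_iff two_ne_zero |>.mp (le_antisymm h4 (sq_nonneg _))

/-- The residual of a least-squares fit is orthogonal to every column used in the fit. -/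
theorem dotProduct_leastSquares_residual_eq_zero {d k : ℕ} {D : Matrix (Fin d) (Fin k) ℝ}
    {U : Finset (Fin k)} {x : Fin d → ℝ} {w : Fin k → ℝ} (hw : ∀ j ∉ U, w j = 0)
    (hmin : ∀ w' : Fin k → ℝ, (∀ j ∉ U, w' j = 0) →
      norm2 (x - ∑ j, w j • (fun i => D i j)) ≤ norm2 (x - ∑ j, w' j • (fun i => D i j)))
    {j : Fin k} (hj : j ∈ U) :
    (x - ∑ j, w j • (fun i => D i j)) ⬝ᵥ (fun i => D i j) = 0 := by
  refine dotProduct_eq_zero_of_norm2_le fun ε => ?_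
  convert hmin (w + Pi.single j ε) fun l hl => ?_ using 2
  · simp [add_smul, Finset.sum_add_distrib, Pi.single_apply, sub_sub]
  · have : l ≠ j := fun h => hl (h ▸ hj)
    simp [hw l hl, this]

theorem eq_zero_of_dotProduct_columns_eq_zero {d k : ℕ} {D : Matrix (Fin d) (Fin k) ℝ}
    {S : Finset (Fin k)} {c : Fin k → ℝ} {r : Fin d → ℝ}
    (hr : r = ∑ j ∈ S, c j • (fun i => D i j))
    (h : ∀ j ∈ S, r ⬝ᵥ (fun i => D i j) = 0) : r = 0 := by
  refine dotProduct_self_eq_zero.mp ?_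
  nth_rewrite 2 [hr]
  rw [dotProduct_sum]
  exact Finset.sum_eq_zero fun j hj => by rw [dotProduct_smul, h j hj, smul_zero]

theorem subCols_normalizeCols_mulVec_injective {d k : ℕ} {D : Matrix (Fin d) (Fin k) ℝ}
    {S : Finset (Fin k)} (hcols : ∀ j, (fun i => D i j) ≠ (0 : Fin d → ℝ))
    (hrank : LinearIndependent ℝ (fun j : {j // j ∈ S} => fun i => D i j.1)) :
    Function.Injective (subCols (normalizeCols D) S).mulVec := by
  rw [Matrix.mulVec_injective_iff]
  have hcol : (subCols (normalizeCols D) S).col =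
      (fun j : {j // j ∈ S} => (Units.mk0 _ (colNorm_pos (hcols j.1)).ne')⁻¹) •
        fun j : {j // j ∈ S} => fun i => D i j.1 := by
    ext j i
    simp [subCols, normalizeCols, Matrix.col, Units.smul_def, div_eq_inv_mul]
  rw [hcol]
  exact hrank.units_smul _

/-- On the range of `D_S`, pairing with `v` factors through the pseudoinverse of `D_S`. -/
theorem dotProduct_subCols_mulVec {d k : ℕ} {D : Matrix (Fin d) (Fin k) ℝ}
    {S : Finset (Fin k)} (hinj : Function.Injective (subCols D S).mulVec)
    (c : {j // j ∈ S} → ℝ) (v : Fin d → ℝ) :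
    (subCols D S *ᵥ c) ⬝ᵥ v =
      ((subCols D S)ᵀ *ᵥ (subCols D S *ᵥ c)) ⬝ᵥ (pinvCols D S *ᵥ v) := by
  have hG : IsUnit ((subCols D S)ᵀ * subCols D S) := by
    simpa using (Matrix.PosDef.conjTranspose_mul_self _ hinj).isUnit
  have hdet := (Matrix.isUnit_iff_isUnit_det _).mp hG
  have hsymm : ((subCols D S)ᵀ * subCols D S)ᵀ = (subCols D S)ᵀ * subCols D S := by simp
  rw [pinvCols, mulVec_mulVec, ← mulVec_mulVec v,
    ← vecMul_transpose ((subCols D S)ᵀ * subCols D S), hsymm, ← dotProduct_mulVec, mulVec_mulVec, Matrix.mul_nonsing_inv _ hdet, one_mulVec,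
    dotProduct_mulVec, vecMul_transpose]

theorem sum_abs_pinvCols_mulVec_lt_one {d k : ℕ} {D : Matrix (Fin d) (Fin k) ℝ}
    {S T : Finset (Fin k)} (hERC : ERC D S T < 1) {j : Fin k} (hj : j ∈ T \ S) :
    ∑ i, |(pinvCols D S *ᵥ fun i' => D i' j) i| < 1 := by
  have h := (Finset.le_sup (f := fun j =>
    ∑ i, ‖(pinvCols D S *ᵥ fun i' => D i' j) i‖₊) hj).trans_lt hERC
  simpa [← Real.norm_eq_abs] using NNReal.coe_lt_coe.mpr h

theorem abs_dotProduct_normalizeCols {d k : ℕ} {D : Matrix (Fin d) (Fin k) ℝ} {j : Fin k}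
    (r : Fin d → ℝ) :
    |r ⬝ᵥ (fun i => normalizeCols D i j)| = |r ⬝ᵥ (fun i => D i j)| / colNorm D j := by
  have h : (fun i => normalizeCols D i j) = (colNorm D j)⁻¹ • fun i => D i j := by
    ext i; simp [normalizeCols, div_eq_inv_mul]
  rw [h, dotProduct_smul, smul_eq_mul, abs_mul, abs_inv, div_eq_inv_mul,
    abs_of_nonneg (show 0 ≤ colNorm D j from Real.sqrt_nonneg _)]

/-- If the exact recovery coefficient is below one, then a nonzero vector in the span of the
columns in `S` correlates strictly better with some column in `S` than with any column in
`T \ S`. -/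
theorem exists_correlation_lt_of_ERC_lt_one {d k : ℕ} {D : Matrix (Fin d) (Fin k) ℝ}
    {S T : Finset (Fin k)} (hcols : ∀ j, (fun i => D i j) ≠ (0 : Fin d → ℝ))
    (hrank : LinearIndependent ℝ (fun j : {j // j ∈ S} => fun i => D i j.1))
    (hERC : ERC (normalizeCols D) S T < 1) {c : Fin k → ℝ} {r : Fin d → ℝ}
    (hr : r = ∑ j ∈ S, c j • (fun i => D i j)) (hr0 : r ≠ 0) {j : Fin k} (hj : j ∈ T \ S) :
    ∃ l ∈ S, |r ⬝ᵥ (fun i => D i j)| / colNorm D j < |r ⬝ᵥ (fun i => D i l)| / colNorm D l := by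
  have hex : ∃ l ∈ S, r ⬝ᵥ (fun i => D i l) ≠ 0 := by
    by_contra! h
    exact hr0 (eq_zero_of_dotProduct_columns_eq_zero hr h)
  obtain ⟨l₀, hl₀, hne⟩ := hex
  obtain ⟨l, hl, hmax⟩ := S.exists_max_image
    (fun l => |r ⬝ᵥ (fun i => D i l)| / colNorm D l) ⟨l₀, hl₀⟩
  have hpos : 0 < |r ⬝ᵥ (fun i => D i l)| / colNorm D l :=
    (div_pos (abs_pos.mpr hne) (colNorm_pos (hcols l₀))).trans_le (hmax l₀ hl₀)
  refine ⟨l, hl, ?_⟩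
  have hrange : r = subCols (normalizeCols D) S *ᵥ fun i => c i.1 * colNorm D i.1 := by
    rw [hr, ← Finset.sum_coe_sort]
    ext i
    simp only [Finset.sum_apply, Pi.smul_apply, smul_eq_mul, mulVec, dotProduct, subCols,
      normalizeCols, of_apply]
    refine Finset.sum_congr rfl fun l _ => ?_
    have := (colNorm_pos (hcols l.1)).ne'
    field_simp
  have hpair := dotProduct_subCols_mulVec
    (subCols_normalizeCols_mulVec_injective hcols hrank)
    (fun i => c i.1 * colNorm D i.1) (fun i => normalizeCols D i j)
  rw [← hrange] at hpair
  rw [← abs_dotProduct_normalizeCols, hpair, dotProduct]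
  refine (Finset.abs_sum_le_sum_abs _ _).trans_lt ?_
  refine lt_of_le_of_lt (Finset.sum_le_sum fun i _ => ?_)
    ((Finset.mul_sum _ _ _).symm.trans_lt
      (mul_lt_of_lt_one_right hpos (sum_abs_pinvCols_mulVec_lt_one hERC hj)))
  rw [abs_mul]
  refine mul_le_mul_of_nonneg_right ?_ (abs_nonneg _)
  refine le_trans (le_of_eq ?_) (hmax i.1 i.2)
  rw [← abs_dotProduct_normalizeCols, dotProduct_comm]
  rfl

/-- **ERC threshold implies restricted OMP success.**
Let `D` have nonzero columns, `S ⊆ T` nonempty of size `s` with `D_S` of full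
column rank, and suppose the restricted ERC of the column-normalized dictionary
satisfies `ERC(D̂; S | T) < 1`.  Let `x = ∑_{j ∈ S} z j • d_j` with `z j ≠ 0`
on `S`.  Consider any run of OMP restricted to `T` with the cosine-similarity
selection rule: `S⁰ = ∅`, `r⁰ = x`; at step `t` the selected index `sel t ∈ T`
maximizes `j ↦ |⟨r^t, d_j⟩| / ‖d_j‖₂` over `j ∈ T`; `S^{t+1} = S^t ∪ {sel t}`;
and `r^{t+1}` is the least-squares residual of `x` over the columns in
`S^{t+1}`.  Then for every `t < s` the residual `r^t` is nonzero and every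
maximizer of the selection rule over `T` lies in `S \ S^t`; and after `s`
iterations `S^s = S` and `r^s = 0`. -/
theorem omp_exact_recovery_of_erc_lt_one
    {d k : ℕ} (D : Matrix (Fin d) (Fin k) ℝ)
    (hcols : ∀ j, (fun i => D i j) ≠ (0 : Fin d → ℝ))
    (T S : Finset (Fin k)) (hST : S ⊆ T) (hSne : S.Nonempty)
    (hrank : LinearIndependent ℝ (fun j : {j // j ∈ S} => fun i => D i j.1))
    (hERC : ERC (normalizeCols D) S T < 1)
    (z : Fin k → ℝ) (hz : ∀ j ∈ S, z j ≠ 0)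
    (x : Fin d → ℝ) (hx : x = ∑ j ∈ S, z j • (fun i => D i j))
    (Ssup : ℕ → Finset (Fin k)) (r : ℕ → Fin d → ℝ) (sel : ℕ → Fin k)
    (hS0 : Ssup 0 = ∅) (hr0 : r 0 = x)
    (hsel : ∀ t, sel t ∈ T ∧ ∀ j ∈ T,
      |dotProduct (r t) (fun i => D i j)| / colNorm D j ≤
        |dotProduct (r t) (fun i => D i (sel t))| / colNorm D (sel t))
    (hSstep : ∀ t, Ssup (t + 1) = insert (sel t) (Ssup t))
    (hrstep : ∀ t, ∃ w : Fin k → ℝ,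
      (∀ j ∉ Ssup (t + 1), w j = 0) ∧
      (∀ w' : Fin k → ℝ, (∀ j ∉ Ssup (t + 1), w' j = 0) →
        norm2 (x - ∑ j, w j • (fun i => D i j)) ≤
          norm2 (x - ∑ j, w' j • (fun i => D i j))) ∧
      r (t + 1) = x - ∑ j, w j • (fun i => D i j)) :
    (∀ t < S.card, r t ≠ 0 ∧
      ∀ j ∈ T, (∀ j' ∈ T,
          |dotProduct (r t) (fun i => D i j')| / colNorm D j' ≤
            |dotProduct (r t) (fun i => D i j)| / colNorm D j) →
        j ∈ S \ Ssup t) ∧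
    Ssup S.card = S ∧ r S.card = 0 := by
  have hspan_ne : ∀ (U : Finset (Fin k)) (c : Fin k → ℝ) (v : Fin d → ℝ), U ⊆ S →
      U.card < S.card → v = ∑ j ∈ S, c j • (fun i => D i j) →
      (∀ j ∈ S, j ∉ U → c j = z j) → v ≠ 0 := by
    rintro U c v hUS hcard hv hc rfl
    obtain ⟨j, hjS, hjU⟩ := Finset.exists_mem_notMem_of_card_lt_card hcard
    rw [← Finset.sum_coe_sort] at hv
    have h0 := Fintype.linearIndependent_iff.mp hrank (fun i => c i.1) hv.symm ⟨j, hjS⟩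
    exact hz j hjS ((hc j hjS hjU).symm.trans h0)
  have hmaximizer : ∀ (U : Finset (Fin k)) (c : Fin k → ℝ) (v : Fin d → ℝ),
      v = ∑ j ∈ S, c j • (fun i => D i j) → v ≠ 0 →
      (∀ j ∈ U, v ⬝ᵥ (fun i => D i j) = 0) → ∀ j ∈ T,
      (∀ j' ∈ T, |v ⬝ᵥ (fun i => D i j')| / colNorm D j' ≤
        |v ⬝ᵥ (fun i => D i j)| / colNorm D j) → j ∈ S \ U := by
    intro U c v hv hv0 horth j hjT hmax
    refine Finset.mem_sdiff.mpr ⟨?_, fun hjU => ?_⟩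
    · by_contra hjS
      obtain ⟨l, hl, hlt⟩ := exists_correlation_lt_of_ERC_lt_one hcols hrank hERC hv hv0
        (Finset.mem_sdiff.mpr ⟨hjT, hjS⟩)
      exact (hmax l (hST hl)).not_gt hlt
    · refine hv0 (eq_zero_of_dotProduct_columns_eq_zero hv fun l hl => ?_)
      by_contra hne
      have h := hmax l (hST hl)
      rw [horth j hjU, abs_zero, zero_div] at h
      exact h.not_gt (div_pos (abs_pos.mpr hne) (colNorm_pos (hcols l)))
  have hinv : ∀ t ≤ S.card, Ssup t ⊆ S ∧ (Ssup t).card = t ∧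
      (∀ j ∈ Ssup t, r t ⬝ᵥ (fun i => D i j) = 0) ∧
      ∃ c : Fin k → ℝ, r t = ∑ j ∈ S, c j • (fun i => D i j) ∧
        ∀ j ∈ S, j ∉ Ssup t → c j = z j := by
    intro t
    induction t with
    | zero =>
      intro _
      simp only [hS0, hr0]
      exact ⟨by simp, by simp, by simp, z, hx, fun _ _ _ => rfl⟩
    | succ t ih =>
      intro ht
      obtain ⟨hsub, hcard, horth, c, hc, hcz⟩ := ih (by omega)
      have hmem := hmaximizer (Ssup t) c (r t) hc
        (hspan_ne (Ssup t) c _ hsub (by omega) hc hcz) horth _ (hsel t).1 (hsel t).2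
      obtain ⟨hselS, hselU⟩ := Finset.mem_sdiff.mp hmem
      have hsub' : Ssup (t + 1) ⊆ S := by
        rw [hSstep]
        exact Finset.insert_subset hselS hsub
      obtain ⟨w, hw, hmin, hrt⟩ := hrstep t
      refine ⟨hsub', by rw [hSstep, Finset.card_insert_of_notMem hselU, hcard],
        fun j hj => ?_, z - w, ?_, fun j _ hj => by simp [hw j hj]⟩
      · rw [hrt]
        exact dotProduct_leastSquares_residual_eq_zero hw hmin hj
      · have hsum : ∑ j, w j • (fun i => D i j) = ∑ j ∈ S, w j • (fun i => D i j) := by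
          refine (Finset.sum_subset (Finset.subset_univ S) fun j _ hj => ?_).symm
          rw [hw j fun h => hj (hsub' h), zero_smul]
        rw [hrt, hsum, hx, ← Finset.sum_sub_distrib]
        simp only [Pi.sub_apply, sub_smul]
  refine ⟨fun t ht => ?_, ?_⟩
  · obtain ⟨hsub, hcard, horth, c, hc, hcz⟩ := hinv t ht.le
    have hne := hspan_ne (Ssup t) c _ hsub (by omega) hc hcz
    exact ⟨hne, hmaximizer (Ssup t) c (r t) hc hne horth⟩
  · obtain ⟨hsub, hcard, horth, c, hc, -⟩ := hinv S.card le_rfl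
    have heq : Ssup S.card = S := Finset.eq_of_subset_of_card_le hsub hcard.ge
    exact ⟨heq, eq_zero_of_dotProduct_columns_eq_zero hc fun j hj => horth j (by rwa [heq])⟩
end

section
/- There exist natural numbers d and k, a matrix D ∈ ℝ^{d×k} with unit-norm columns, a subset S ⊆ {1,…,k} such that D_S has full column rank, and a subset T with S ⊆ T ⊆ {1,…,k} and T∖S ≠ ∅, such that the global exact recovery coefficient fails, ERC(D; S) = max_{j ∈ {1,…,k}∖S} ‖D_S† d_j‖₁ ≥ 1, while the restricted exact recovery coefficient succeeds, ERC(D; S | T) = max_{j ∈ T∖S} ‖D_S† d_j‖₁ < 1. Consequently, the ERC-certified success region of OMP restricted to the subtree columns T is strictly larger than that of OMP on the full dictionary. -/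
open Matrix
open scoped NNReal

/-- If the columns indexed by `S` are orthonormal, then `D_S† = D_Sᵀ`. -/
theorem pinvCols_eq_transpose {d k : ℕ} {D : Matrix (Fin d) (Fin k) ℝ} {S : Finset (Fin k)}
    (h : (subCols D S)ᵀ * subCols D S = 1) : pinvCols D S = (subCols D S)ᵀ := by
  rw [pinvCols, h, inv_one, Matrix.one_mul]

/-- Orthonormal columns are linearly independent. -/
theorem linearIndependent_subCols {d k : ℕ} {D : Matrix (Fin d) (Fin k) ℝ} {S : Finset (Fin k)}
    (h : (subCols D S)ᵀ * subCols D S = 1) :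
    LinearIndependent ℝ (fun j : {j // j ∈ S} => fun i => D i j.1) := by
  apply (Matrix.mulVec_injective_iff (M := subCols D S)).mp
  intro v w hvw
  simpa [Matrix.mulVec_mulVec, h] using congrArg ((subCols D S)ᵀ *ᵥ ·) hvw

/-- For orthonormal columns on `S`, the recovery coefficient is a maximum of sums of
absolute inner products. -/
theorem ERC_eq_of_orthonormal {d k : ℕ} {D : Matrix (Fin d) (Fin k) ℝ} {S : Finset (Fin k)}
    (h : (subCols D S)ᵀ * subCols D S = 1) (T : Finset (Fin k)) :
    ERC D S T = (T \ S).sup fun j => ∑ i ∈ S, ‖∑ l, D l i * D l j‖₊ := by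
  refine Finset.sup_congr rfl fun j _ => ?_
  rw [pinvCols_eq_transpose h, ← Finset.sum_coe_sort S]
  rfl

/-- The dictionary `e₁, e₂, e₃, (3/5, 4/5, 0)` in `ℝ³`. -/
noncomputable def exampleDict : Matrix (Fin 3) (Fin 4) ℝ :=
  !![1, 0, 0, 3/5; 0, 1, 0, 4/5; 0, 0, 1, 0]

theorem exampleDict_orthonormal :
    (subCols exampleDict {0, 1})ᵀ * subCols exampleDict {0, 1} = 1 := by
  ext ⟨i, hi⟩ ⟨j, hj⟩
  simp only [Finset.mem_insert, Finset.mem_singleton] at hi hj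
  rcases hi with rfl | rfl <;> rcases hj with rfl | rfl <;>
    simp [Matrix.mul_apply, subCols, exampleDict, Fin.sum_univ_three]

/-- **Strictly larger ERC-certified success region for Hierarchical OMP.**
There exist dimensions `d, k`, a dictionary `D ∈ ℝ^{d×k}` with unit-norm
columns, a support `S` whose submatrix `D_S` has full column rank, and a subset
`T` with `S ⊆ T` and `T \ S ≠ ∅`, such that the global exact recovery
coefficient fails (`ERC(D; S) ≥ 1`) while the restricted one succeeds
(`ERC(D; S | T) < 1`).  Hence the ERC-certified success region of OMP
restricted to `T` is strictly larger than that of OMP on the full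
dictionary. -/
theorem exists_erc_fail_global_succeed_restricted :
    ∃ (d k : ℕ) (D : Matrix (Fin d) (Fin k) ℝ) (S T : Finset (Fin k)),
      (∀ j, ∑ i, (D i j) ^ 2 = 1) ∧
      LinearIndependent ℝ (fun j : {j // j ∈ S} => fun i => D i j.1) ∧
      S ⊆ T ∧ (T \ S).Nonempty ∧
      1 ≤ ERC D S Finset.univ ∧ ERC D S T < 1 := by
  have h := exampleDict_orthonormal
  refine ⟨3, 4, exampleDict, {0, 1}, {0, 1, 2}, ?_, linearIndependent_subCols h, by decide,
    by decide, ?_, ?_⟩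
  · intro j
    fin_cases j <;> norm_num [exampleDict, Fin.sum_univ_succ]
  · rw [ERC_eq_of_orthonormal h]
    refine le_trans ?_ (Finset.le_sup (b := (3 : Fin 4)) (by decide))
    rw [← NNReal.coe_le_coe]
    simp [exampleDict, Fin.sum_univ_three]
    norm_num [abs_of_pos]
  · rw [ERC_eq_of_orthonormal h,
      show ({0, 1, 2} \ {0, 1} : Finset (Fin 4)) = {2} by decide]
    simp [exampleDict, Fin.sum_univ_three]
end

section
/- Let b ≥ 2 and l ≥ 0 be natural numbers with d ≥ l + b, let a_0, a_1, …, a_l ∈ ℝ^d be linearly independent vectors such that ⟨a_l − a_k, a_k⟩ = 0 for every k < l (so the current parent a_l satisfies hierarchical orthogonality with respect to its ancestors; in particular a_l ≠ 0), let θ ∈ (0, π/2), and set λ = ‖a_l‖ · tan θ. Then there exist vectors c_1, …, c_b ∈ ℝ^d such that: (i) hierarchical orthogonality: ⟨c_j − a_k, a_k⟩ = 0 for every j ∈ {1,…,b} and every k ∈ {0,…,l}; (ii) regular simplex structure: ⟨c_j − a_l, c_{j'} − a_l⟩ = λ² if j = j' and −λ²/(b−1) if j ≠ j'; and (iii) cone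 condition: ∠(c_j, a_l) = θ for every j. -/
open InnerProductGeometry Real
open scoped RealInnerProductSpace

/-- An inner product space of dimension at least `n` contains `n + 1` vectors with the Gram matrix of
the vertices of a centred regular simplex, `δ i j - 1 / (n + 1)`. -/
theorem exists_inner_eq_ite_sub_inv {E : Type*} [NormedAddCommGroup E] [InnerProductSpace ℝ E]
    [FiniteDimensional ℝ E] {n : ℕ} (hn : n ≤ Module.finrank ℝ E) :
    ∃ w : Fin (n + 1) → E, ∀ i j, ⟪w i, w j⟫ = (if i = j then 1 else 0) - ((n : ℝ) + 1)⁻¹ := by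
  have hn0 : (n : ℝ) + 1 ≠ 0 := by positivity
  obtain ⟨one, h1⟩ : ∃ v : EuclideanSpace ℝ (Fin (n + 1)), ∀ i, v i = 1 :=
    ⟨WithLp.toLp 2 fun _ => 1, fun _ => rfl⟩
  have hoo : ⟪one, one⟫ = (n : ℝ) + 1 := by rw [PiLp.inner_apply]; simp [h1]
  have hone : one ≠ 0 := by
    rintro rfl
    simpa using h1 0
  have : Fact (Module.finrank ℝ (EuclideanSpace ℝ (Fin (n + 1))) = n + 1) := ⟨by simp⟩
  have hV : Module.finrank ℝ (ℝ ∙ one)ᗮ = n := Submodule.finrank_orthogonal_span_singleton hone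
  have B := (stdOrthonormalBasis ℝ (ℝ ∙ one)ᗮ).reindex (finCongr hV)
  obtain ⟨p, hp⟩ : ∃ p : Fin (n + 1) → (ℝ ∙ one)ᗮ,
      ∀ i j, ⟪p i, p j⟫ = (if i = j then 1 else 0) - ((n : ℝ) + 1)⁻¹ := by
    have hmem : ∀ i, EuclideanSpace.single i 1 - ((n : ℝ) + 1)⁻¹ • one ∈ (ℝ ∙ one)ᗮ := by
      intro i
      rw [Submodule.mem_orthogonal_singleton_iff_inner_right, inner_sub_right, inner_smul_right,
        hoo, EuclideanSpace.inner_single_right]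
      simp [h1, hn0]
    refine ⟨fun i => ⟨_, hmem i⟩, fun i j => ?_⟩
    simp only [Submodule.coe_inner, inner_sub_left, inner_sub_right, inner_smul_left,
      inner_smul_right, hoo, EuclideanSpace.inner_single_left, EuclideanSpace.inner_single_right]
    simp [h1, hn0, eq_comm]
  have hu : Orthonormal ℝ fun i => stdOrthonormalBasis ℝ E (Fin.castLE hn i) :=
    (stdOrthonormalBasis ℝ E).orthonormal.comp _ (Fin.castLE_injective hn)
  refine ⟨fun j => ∑ i, B.repr (p j) i • stdOrthonormalBasis ℝ E (Fin.castLE hn i),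
    fun i j => ?_⟩
  rw [hu.inner_sum, ← hp i j, ← B.repr.inner_map_map, PiLp.inner_apply]
  simp [mul_comm]

/-- An inner product space of dimension at least `b - 1` contains a regular simplex of `b` vectors of
any prescribed parameter. -/
theorem exists_inner_eq_simplex {E : Type*} [NormedAddCommGroup E] [InnerProductSpace ℝ E]
    [FiniteDimensional ℝ E] {b : ℕ} (hb : 2 ≤ b) (hd : b ≤ Module.finrank ℝ E + 1) (r : ℝ) :
    ∃ w : Fin b → E, ∀ i j, ⟪w i, w j⟫ = if i = j then r ^ 2 else -(r ^ 2 / ((b : ℝ) - 1)) := by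
  obtain ⟨n, rfl⟩ : ∃ n, b = n + 1 := ⟨b - 1, by omega⟩
  obtain ⟨w, hw⟩ := exists_inner_eq_ite_sub_inv (E := E) (n := n) (by omega)
  have hn : (0 : ℝ) < n := by exact_mod_cast (by omega : 0 < n)
  have hs : √(((n : ℝ) + 1) / n) ^ 2 = ((n : ℝ) + 1) / n := Real.sq_sqrt (by positivity)
  refine ⟨fun i => (r * √(((n : ℝ) + 1) / n)) • w i, fun i j => ?_⟩
  rw [inner_smul_left, inner_smul_right, hw, conj_trivial, ← mul_assoc, ← sq, mul_pow, hs]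
  rw [Nat.cast_succ, add_sub_cancel_right]
  split_ifs <;> field_simp <;> ring

/-- **Step-by-step construction of children satisfying hierarchical
orthogonality, regular simplex structure, and the cone condition.**
Let `b ≥ 2`, `d ≥ l + b`, let `a 0, …, a l ∈ ℝ^d` be linearly independent with
the current parent `a l` satisfying hierarchical orthogonality w.r.t. its
ancestors (`⟪a l - a k, a k⟫ = 0` for `k < l`), let `θ ∈ (0, π/2)` and set
`λ = ‖a l‖ · tan θ`.  Then there exist children `c 1, …, c b ∈ ℝ^d` with:
(i) hierarchical orthogonality `⟪c j - a k, a k⟫ = 0` for all `j`, `k`;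
(ii) regular simplex structure `⟪c j - a l, c j' - a l⟫ = λ²` if `j = j'` and
`-λ²/(b-1)` otherwise; and (iii) the cone condition `∠(c j, a l) = θ` for
every `j`. -/
theorem exists_children_hierarchical_simplex_cone
    {d b l : ℕ} (hb : 2 ≤ b) (hd : l + b ≤ d)
    (a : Fin (l + 1) → EuclideanSpace ℝ (Fin d))
    (hli : LinearIndependent ℝ a)
    (horth : ∀ k : Fin (l + 1), k < Fin.last l →
      ⟪a (Fin.last l) - a k, a k⟫ = 0)
    (θ : ℝ) (hθ0 : 0 < θ) (hθ1 : θ < π / 2) :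
    ∃ c : Fin b → EuclideanSpace ℝ (Fin d),
      (∀ (j : Fin b) (k : Fin (l + 1)), ⟪c j - a k, a k⟫ = 0) ∧
      (∀ j j' : Fin b, ⟪c j - a (Fin.last l), c j' - a (Fin.last l)⟫ =
        if j = j' then (‖a (Fin.last l)‖ * Real.tan θ) ^ 2
        else -((‖a (Fin.last l)‖ * Real.tan θ) ^ 2 / ((b : ℝ) - 1))) ∧
      (∀ j : Fin b, angle (c j) (a (Fin.last l)) = θ) := by
  have hal : a (Fin.last l) ≠ 0 := hli.ne_zero _
  let S := Submodule.span ℝ (Set.range a)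
  have hS : Module.finrank ℝ S = l + 1 := by simpa using finrank_span_eq_card hli
  have hSo : Module.finrank ℝ S + Module.finrank ℝ Sᗮ = d := by
    simpa using S.finrank_add_finrank_orthogonal
  obtain ⟨w, hw⟩ := exists_inner_eq_simplex (E := Sᗮ) hb (by omega)
    (‖a (Fin.last l)‖ * Real.tan θ)
  have hwa : ∀ j k, ⟪a k, (w j : EuclideanSpace ℝ (Fin d))⟫ = 0 := fun j k =>
    (w j).2 _ (Submodule.subset_span ⟨k, rfl⟩)
  have htan : 0 < Real.tan θ := Real.tan_pos_of_pos_of_lt_pi_div_two hθ0 hθ1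
  refine ⟨fun j => a (Fin.last l) + w j, fun j k => ?_, fun j j' => ?_, fun j => ?_⟩
  · rw [add_sub_right_comm, inner_add_left, real_inner_comm (a k) (w j : EuclideanSpace ℝ _),
      hwa, add_zero]
    rcases (Fin.le_last k).lt_or_eq with hk | rfl
    · exact horth k hk
    · simp
  · simpa using hw j j'
  · have hnorm : ‖(w j : EuclideanSpace ℝ (Fin d))‖ = ‖a (Fin.last l)‖ * Real.tan θ := by
      have h := hw j j
      rw [if_pos rfl, real_inner_self_eq_norm_sq] at h
      exact (sq_eq_sq₀ (norm_nonneg _) (by positivity)).1 h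
    rw [angle_comm, angle_add_eq_arctan_of_inner_eq_zero (hwa j _) hal, hnorm,
      mul_div_cancel_left₀ _ (norm_ne_zero_iff.2 hal), Real.arctan_tan (by linarith) hθ1]
end
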